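/- Let U ⊆ ℂ² be open and ρ : U → ℝ smooth with ρ > 0 and Levi matrix H(ρ) positive definite on U, satisfying the Monge–Ampère equation Z(ρ) := Σ_μ Z^μ·∂ρ/∂z_μ = ρ on U, where Z is the complex gradient; let L be the (1,0) vector field with components L¹ = ∂ρ/∂z₂, L² = −∂ρ/∂z₁. Then at every z ∈ U there exists c ∈ ℂ such that L(Z^μ)(z) − Z(L^μ)(z) = c·L^μ(z) for μ = 1,2; i.e. the bracket [L, Z], which is the (1,0) vector field with components L(Z^μ) − Z(L^μ), is pointwise a complex multiple of L. -/

import Mathlib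

open Complex Matrix
open scoped ComplexOrder

/-- The Wirtinger derivative `∂f/∂z_μ` of an `ℝ`-differentiable function `f : ℂⁿ → ℂ`. -/
noncomputable def wD {n : ℕ} (f : (Fin n → ℂ) → ℂ) (z : Fin n → ℂ) (μ : Fin n) : ℂ :=
  (1 / 2 : ℂ) *
    (fderiv ℝ f z (Pi.single μ 1) - Complex.I * fderiv ℝ f z (Pi.single μ Complex.I))

/-- The conjugate Wirtinger derivative `∂f/∂z̄_μ`. -/
noncomputable def wDbar {n : ℕ} (f : (Fin n → ℂ) → ℂ) (z : Fin n → ℂ) (μ : Fin n) : ℂ :=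
  (1 / 2 : ℂ) *
    (fderiv ℝ f z (Pi.single μ 1) + Complex.I * fderiv ℝ f z (Pi.single μ Complex.I))

/-- The Levi matrix `ρ_{μν̄} = ∂²ρ/∂z_μ∂z̄_ν` of a real-valued function `ρ : ℂⁿ → ℝ`. -/
noncomputable def levi {n : ℕ} (ρ : (Fin n → ℂ) → ℝ) (z : Fin n → ℂ) :
    Matrix (Fin n) (Fin n) ℂ :=
  Matrix.of fun μ ν => wD (fun w => wDbar (fun w' => (ρ w' : ℂ)) w ν) z μ

/-- The tangential `(1,0)` vector field `L` with components `L¹ = ∂ρ/∂z₂`,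
`L² = −∂ρ/∂z₁`. -/
noncomputable def Lfield (ρ : (Fin 2 → ℂ) → ℝ) (z : Fin 2 → ℂ) : Fin 2 → ℂ :=
  ![wD (fun w => (ρ w : ℂ)) z 1, -(wD (fun w => (ρ w : ℂ)) z 0)]

/-- Action of a `(1,0)` vector field `W`: `Wf = Σ_μ W^μ ∂f/∂z_μ`. -/
noncomputable def op10 {n : ℕ} (W : (Fin n → ℂ) → Fin n → ℂ) (f : (Fin n → ℂ) → ℂ)
    (z : Fin n → ℂ) : ℂ :=
  ∑ μ : Fin n, W z μ * wD f z μ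

/-- Action of the conjugate field `W̄`: `W̄f = Σ_μ conj(W^μ) ∂f/∂z̄_μ`. -/
noncomputable def op01 {n : ℕ} (W : (Fin n → ℂ) → Fin n → ℂ) (f : (Fin n → ℂ) → ℂ)
    (z : Fin n → ℂ) : ℂ :=
  ∑ μ : Fin n, (starRingEnd ℂ) (W z μ) * wDbar f z μ

lemma wD_mul {n : ℕ} {f g : (Fin n → ℂ) → ℂ} {z : Fin n → ℂ}
    (hf : DifferentiableAt ℝ f z) (hg : DifferentiableAt ℝ g z) (μ : Fin n) :
    wD (fun w => f w * g w) z μ = wD f z μ * g z + f z * wD g z μ := by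
  simp only [wD, fderiv_fun_mul hf hg, _root_.add_apply,
    _root_.smul_apply, smul_eq_mul]
  ring

lemma wD_add {n : ℕ} {f g : (Fin n → ℂ) → ℂ} {z : Fin n → ℂ}
    (hf : DifferentiableAt ℝ f z) (hg : DifferentiableAt ℝ g z) (μ : Fin n) :
    wD (fun w => f w + g w) z μ = wD f z μ + wD g z μ := by
  simp only [wD, fderiv_fun_add hf hg, _root_.add_apply]
  ring

lemma wD_neg {n : ℕ} (f : (Fin n → ℂ) → ℂ) (z : Fin n → ℂ) (μ : Fin n) :
    wD (fun w => -f w) z μ = -wD f z μ := by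
  simp only [wD, fderiv_fun_neg, _root_.neg_apply]
  ring

lemma Filter.EventuallyEq.wD_eq {n : ℕ} {f g : (Fin n → ℂ) → ℂ} {z : Fin n → ℂ}
    (h : f =ᶠ[nhds z] g) (μ : Fin n) : wD f z μ = wD g z μ := by
  simp only [wD, h.fderiv_eq]

lemma ContDiffAt.fderiv_apply_const {E F : Type*} [NormedAddCommGroup E] [NormedSpace ℝ E]
    [NormedAddCommGroup F] [NormedSpace ℝ F] {f : E → F} {z : E}
    (hf : ContDiffAt ℝ (⊤ : ℕ∞) f z) (v : E) :
    ContDiffAt ℝ (⊤ : ℕ∞) (fun w => fderiv ℝ f w v) z :=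
  (hf.fderiv_right (m := ((⊤ : ℕ∞) : WithTop ℕ∞)) (by simp)).clm_apply contDiffAt_const

lemma ContDiffAt.wD {n : ℕ} {f : (Fin n → ℂ) → ℂ} {z : Fin n → ℂ}
    (hf : ContDiffAt ℝ (⊤ : ℕ∞) f z) (μ : Fin n) :
    ContDiffAt ℝ (⊤ : ℕ∞) (fun w => wD f w μ) z :=
  contDiffAt_const.mul
    ((hf.fderiv_apply_const _).sub (contDiffAt_const.mul (hf.fderiv_apply_const _)))

lemma ContDiffAt.wDbar {n : ℕ} {f : (Fin n → ℂ) → ℂ} {z : Fin n → ℂ}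
    (hf : ContDiffAt ℝ (⊤ : ℕ∞) f z) (μ : Fin n) :
    ContDiffAt ℝ (⊤ : ℕ∞) (fun w => wDbar f w μ) z :=
  contDiffAt_const.mul
    ((hf.fderiv_apply_const _).add (contDiffAt_const.mul (hf.fderiv_apply_const _)))

lemma fderiv_wD_apply {n : ℕ} {f : (Fin n → ℂ) → ℂ} {z : Fin n → ℂ}
    (hf : ContDiffAt ℝ (⊤ : ℕ∞) f z) (ν : Fin n) (u : Fin n → ℂ) :
    fderiv ℝ (fun w => wD f w ν) z u =
      (1 / 2 : ℂ) * (fderiv ℝ (fderiv ℝ f) z u (Pi.single ν 1) -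
        Complex.I * fderiv ℝ (fderiv ℝ f) z u (Pi.single ν Complex.I)) := by
  have hd : DifferentiableAt ℝ (fderiv ℝ f) z :=
    (hf.fderiv_right (m := ((⊤ : ℕ∞) : WithTop ℕ∞)) (by simp)).differentiableAt (by simp)
  have hv (v : Fin n → ℂ) : DifferentiableAt ℝ (fun w => fderiv ℝ f w v) z :=
    hd.clm_apply (differentiableAt_const v)
  have happ (v : Fin n → ℂ) :
      fderiv ℝ (fun w => fderiv ℝ f w v) z u = fderiv ℝ (fderiv ℝ f) z u v := by
    rw [fderiv_clm_apply hd (differentiableAt_const v)]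
    simp
  simp only [wD]
  rw [fderiv_const_mul ((hv _).fun_sub ((hv _).const_mul _)), _root_.smul_apply,
    fderiv_fun_sub (hv _) ((hv _).const_mul _), _root_.sub_apply,
    fderiv_const_mul (hv _), _root_.smul_apply, happ, happ]
  simp only [smul_eq_mul]

lemma wD_wD_comm {n : ℕ} {f : (Fin n → ℂ) → ℂ} {z : Fin n → ℂ}
    (hf : ContDiffAt ℝ (⊤ : ℕ∞) f z) (μ ν : Fin n) :
    wD (fun w => wD f w ν) z μ = wD (fun w => wD f w μ) z ν := by
  have hs : IsSymmSndFDerivAt ℝ f z := hf.isSymmSndFDerivAt (by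
    rw [minSmoothness_of_isRCLikeNormedField]; exact ENat.LEInfty.out)
  conv_lhs => rw [wD, fderiv_wD_apply hf, fderiv_wD_apply hf]
  conv_rhs => rw [wD, fderiv_wD_apply hf, fderiv_wD_apply hf]
  rw [hs.eq (Pi.single ν 1) (Pi.single μ 1), hs.eq (Pi.single ν 1) (Pi.single μ Complex.I),
    hs.eq (Pi.single ν Complex.I) (Pi.single μ 1),
    hs.eq (Pi.single ν Complex.I) (Pi.single μ Complex.I)]
  ring

/-- The solution of a `2 × 2` linear system with differentiable data and non-vanishing determinant
is differentiable. -/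
lemma differentiableAt_of_vecMul_eq {E : Type*} [NormedAddCommGroup E] [NormedSpace ℝ E]
    {A : E → Matrix (Fin 2) (Fin 2) ℂ} {b Z : E → Fin 2 → ℂ} {z : E}
    (hA : ∀ i j, DifferentiableAt ℝ (fun w => A w i j) z)
    (hb : ∀ i, DifferentiableAt ℝ (fun w => b w i) z)
    (hdet : ∀ᶠ w in nhds z, (A w).det ≠ 0)
    (hZ : ∀ᶠ w in nhds z, ∀ j, ∑ i, Z w i * A w i j = b w j) (i : Fin 2) :
    DifferentiableAt ℝ (fun w => Z w i) z := by
  have hd : DifferentiableAt ℝ (fun w => (A w 0 0 * A w 1 1 - A w 0 1 * A w 1 0)⁻¹) z := by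
    refine (((hA 0 0).mul (hA 1 1)).sub ((hA 0 1).mul (hA 1 0))).inv ?_
    have := hdet.self_of_nhds
    rwa [Matrix.det_fin_two] at this
  fin_cases i
  · refine ((((hb 0).mul (hA 1 1)).sub ((hb 1).mul (hA 1 0))).mul hd).congr_of_eventuallyEq ?_
    filter_upwards [hdet, hZ] with w hw hw'
    rw [Matrix.det_fin_two] at hw
    have h0 := hw' 0
    have h1 := hw' 1
    simp only [Fin.sum_univ_two] at h0 h1
    simp only [Pi.mul_apply, Pi.sub_apply, Fin.zero_eta]
    rw [eq_mul_inv_iff_mul_eq₀ hw]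
    linear_combination A w 1 1 * h0 - A w 1 0 * h1
  · refine ((((hb 1).mul (hA 0 0)).sub ((hb 0).mul (hA 0 1))).mul hd).congr_of_eventuallyEq ?_
    filter_upwards [hdet, hZ] with w hw hw'
    rw [Matrix.det_fin_two] at hw
    have h0 := hw' 0
    have h1 := hw' 1
    simp only [Fin.sum_univ_two] at h0 h1
    simp only [Pi.mul_apply, Pi.sub_apply, Fin.mk_one]
    rw [eq_mul_inv_iff_mul_eq₀ hw]
    linear_combination A w 0 0 * h1 - A w 0 1 * h0

/-- A vector in the kernel of a nonzero covector `(a, b)` is a multiple of `(b, -a)`. -/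
lemma exists_eq_mul_of_mul_add_mul_eq_zero {K : Type*} [Field K] {a b x y : K}
    (hab : a ≠ 0 ∨ b ≠ 0) (h : x * a + y * b = 0) : ∃ c, x = c * b ∧ y = c * -a := by
  rcases hab with ha | hb
  · refine ⟨-y / a, ?_, ?_⟩ <;> field_simp
    linear_combination h
  · refine ⟨x / b, ?_, ?_⟩ <;> field_simp
    linear_combination h

/-- The bracket `[L, Z]` is pointwise a complex multiple of `L`. -/
theorem bracket_L_Z (U : Set (Fin 2 → ℂ)) (hU : IsOpen U)
    (ρ : (Fin 2 → ℂ) → ℝ) (hρ : ContDiffOn ℝ (⊤ : ℕ∞) ρ U)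
    (hpos : ∀ z ∈ U, 0 < ρ z)
    (hPD : ∀ z ∈ U, (levi ρ z).PosDef)
    (Z : (Fin 2 → ℂ) → Fin 2 → ℂ)
    (hZ : ∀ z ∈ U, ∀ ν : Fin 2,
      ∑ μ : Fin 2, Z z μ * levi ρ z μ ν = wDbar (fun w => (ρ w : ℂ)) z ν)
    (hMA : ∀ z ∈ U, ∑ μ : Fin 2, Z z μ * wD (fun w => (ρ w : ℂ)) z μ = (ρ z : ℂ)) :
    ∀ z ∈ U, ∃ c : ℂ, ∀ μ : Fin 2,
      op10 (Lfield ρ) (fun w => Z w μ) z - op10 Z (fun w => Lfield ρ w μ) z =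
        c * Lfield ρ z μ := by
  intro z hz
  have hnear : ∀ᶠ w in nhds z, w ∈ U := hU.mem_nhds hz
  have hf : ContDiffAt ℝ (⊤ : ℕ∞) (fun w => (ρ w : ℂ)) z :=
    Complex.ofRealCLM.contDiff.contDiffAt.comp z (hρ.contDiffAt hnear)
  set f : (Fin 2 → ℂ) → ℂ := fun w => (ρ w : ℂ)
  have htop : ((⊤ : ℕ∞) : WithTop ℕ∞) ≠ 0 := by simp
  have hZd : ∀ i, DifferentiableAt ℝ (fun w => Z w i) z :=
    differentiableAt_of_vecMul_eq (A := levi ρ) (b := fun w => wDbar f w)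
      (fun i j => ((hf.wDbar j).wD i).differentiableAt htop)
      (fun i => (hf.wDbar i).differentiableAt htop)
      (hnear.mono fun w hw => (hPD w hw).det_pos.ne')
      (hnear.mono hZ)
  have hfd : ∀ i, DifferentiableAt ℝ (fun w => wD f w i) z :=
    fun i => (hf.wD i).differentiableAt htop
  have hMAd (ν : Fin 2) :
      wD (fun w => Z w 0) z ν * wD f z 0 + Z z 0 * wD (fun w => wD f w 0) z ν +
        (wD (fun w => Z w 1) z ν * wD f z 1 + Z z 1 * wD (fun w => wD f w 1) z ν) =
      wD f z ν := by
    rw [← wD_mul (hZd 0) (hfd 0), ← wD_mul (hZd 1) (hfd 1),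
      ← wD_add ((hZd 0).fun_mul (hfd 0)) ((hZd 1).fun_mul (hfd 1))]
    refine Filter.EventuallyEq.wD_eq (hnear.mono fun w hw => ?_) ν
    simpa only [Fin.sum_univ_two] using hMA w hw
  have hne : wD f z 0 ≠ 0 ∨ wD f z 1 ≠ 0 := by
    by_contra! h
    have := hMA z hz
    rw [Fin.sum_univ_two, h.1, h.2, mul_zero, mul_zero, add_zero] at this
    exact (hpos z hz).ne (by exact_mod_cast this)
  have hL0 : (fun w => Lfield ρ w 0) = fun w => wD f w 1 := rfl
  have hL1 : (fun w => Lfield ρ w 1) = fun w => -wD f w 0 := rfl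
  have hLz0 : Lfield ρ z 0 = wD f z 1 := rfl
  have hLz1 : Lfield ρ z 1 = -wD f z 0 := rfl
  obtain ⟨c, hc0, hc1⟩ := exists_eq_mul_of_mul_add_mul_eq_zero
    (x := op10 (Lfield ρ) (fun w => Z w 0) z - op10 Z (fun w => Lfield ρ w 0) z)
    (y := op10 (Lfield ρ) (fun w => Z w 1) z - op10 Z (fun w => Lfield ρ w 1) z) hne (by
      simp only [op10, Fin.sum_univ_two, hL0, hL1, hLz0, hLz1, wD_neg]
      linear_combination wD f z 1 * hMAd 0 - wD f z 0 * hMAd 1 +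
        (Z z 0 * wD f z 0 + Z z 1 * wD f z 1) * wD_wD_comm hf 1 0)
  exact ⟨c, fun μ => by fin_cases μ; exacts [hc0, hc1]⟩
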